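/- arXiv:2501.04893 — 2 statements merged into one kernel-verified Lean document; each statement's English description precedes it below -/
import Mathlib

section
/- Let d be a real number with 2 + 4/N < d < 2* and let C₂ > 0 satisfy G(s) ≤ C₂·|s|^d for all s ∈ ℝ. Let V : ℝ^N → ℝ be continuously differentiable, set Ṽ(x) = x·∇V(x) and Ṽ₊ = max(Ṽ, 0), and assume ‖Ṽ₊‖_{N/2} < 2S, where ‖·‖_{N/2} is the L^{N/2}(ℝ^N)-norm. Let c > 0, λ ∈ ℝ, and let u : ℝ^N → ℝ be continuously differentiable and not identically zero, with ∫ |u|² dx = c, 0 < ∫ |∇u|² dx < ∞, finite integrals ∫ |u|^{2*} dx, ∫ V·u² dx, ∫ Ṽ·u² dx, ∫ g(u)·u dx, ∫ G(u) dx, satisfying S·(∫ |u|^{2*} dx)^{2/2*} ≤ ∫ |∇u|² dx and the two identities: (i) ∫ |∇u|² dx + ∫ V·u² dx + λ·c = ∫ g(u)·u dx; (ii) ((N−2)/(2N))·∫ |∇u|² dx + (1/(2N))·∫ Ṽ·u² dx + (1/2)·∫ V·u² dx + (λ/2)·c = ∫ G(u) dx. Then ∫ |∇u|² dx ≥ ((2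 − ‖Ṽ₊‖_{N/2}·S^{−1})/(N·C_{N,d}·C₂·(β−2)))^{4/(N(d−2)−4)} · c^{(d(N−2)−2N)/(N(d−2)−4)}. -/
open MeasureTheory

/-- Interpolation between `L^p` and `L^q` in terms of integrability of powers. -/
lemma integrable_abs_rpow_of_le_of_le {X : Type*} [MeasurableSpace X] {μ : Measure X}
    {u : X → ℝ} {p d q : ℝ} (hu : AEStronglyMeasurable u μ) (hpd : p ≤ d) (hdq : d ≤ q)
    (hp0 : 0 < p) (hp : Integrable (fun x => |u x| ^ p) μ)
    (hq : Integrable (fun x => |u x| ^ q) μ) : Integrable (fun x => |u x| ^ d) μ := by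
  refine (hp.add hq).mono' ?_ (Filter.Eventually.of_forall fun x => ?_)
  · exact (hu.aemeasurable.norm.pow_const d).aestronglyMeasurable
  · have h0 := abs_nonneg (u x)
    rw [Real.norm_of_nonneg (Real.rpow_nonneg h0 d), Pi.add_apply]
    have hp' := Real.rpow_nonneg h0 p
    have hq' := Real.rpow_nonneg h0 q
    rcases le_total |u x| 1 with h | h
    · linarith [Real.rpow_le_rpow_of_exponent_ge' h0 h hp0.le hpd]
    · linarith [Real.rpow_le_rpow_of_exponent_le h hdq]

/-- Hölder's inequality for a nonnegative weight in `L^p` against a square, in terms of the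
exponent `2 q`, where `q` is conjugate to `p`. -/
lemma integral_mul_sq_le_of_holderConjugate {X : Type*} [MeasurableSpace X] {μ : Measure X}
    {f u : X → ℝ} {p q : ℝ} (hpq : p.HolderConjugate q) (hf0 : ∀ x, 0 ≤ f x)
    (hf : AEStronglyMeasurable f μ) (hu : AEStronglyMeasurable u μ)
    (hfint : Integrable (fun x => f x ^ p) μ) (huint : Integrable (fun x => |u x| ^ (2 * q)) μ) :
    ∫ x, f x * u x ^ 2 ∂μ ≤
      (∫ x, f x ^ p ∂μ) ^ (1 / p) * (∫ x, |u x| ^ (2 * q) ∂μ) ^ (1 / q) := by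
  have hpow : ∀ x, (u x ^ 2) ^ q = |u x| ^ (2 * q) := fun x => by
    rw [← sq_abs, Real.rpow_mul (abs_nonneg _), Real.rpow_two]
  have hfm : MemLp f (ENNReal.ofReal p) μ := by
    rw [← integrable_norm_rpow_iff hf (by simpa using hpq.pos) ENNReal.ofReal_ne_top,
      ENNReal.toReal_ofReal hpq.nonneg]
    simpa only [Real.norm_of_nonneg (hf0 _)] using hfint
  have husq : AEStronglyMeasurable (fun x => u x ^ 2) μ := hu.pow 2
  have hum : MemLp (fun x => u x ^ 2) (ENNReal.ofReal q) μ := by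
    rw [← integrable_norm_rpow_iff husq (by simpa using hpq.symm.pos)
      ENNReal.ofReal_ne_top, ENNReal.toReal_ofReal hpq.symm.nonneg]
    simpa only [Real.norm_of_nonneg (sq_nonneg _), hpow] using huint
  simpa only [hpow] using integral_mul_le_Lp_mul_Lq_of_nonneg hpq
    (Filter.Eventually.of_forall hf0) (Filter.Eventually.of_forall fun x => sq_nonneg (u x))
    hfm hum

/-- Lower bound on `A` from the superlinear inequality `a * A ≤ b * c ^ e * A ^ p`. -/
lemma rpow_mul_rpow_le_of_mul_le {a b c e p A : ℝ} (ha : 0 ≤ a) (hb : 0 < b) (hc : 0 < c)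
    (hA : 0 < A) (hp : 1 < p) (h : a * A ≤ b * c ^ e * A ^ p) :
    (a / b) ^ (1 / (p - 1)) * c ^ (-e / (p - 1)) ≤ A := by
  have hp' : 0 < p - 1 := sub_pos.2 hp
  have hce := Real.rpow_pos_of_pos hc e
  have hbase : a / b * c ^ (-e) ≤ A ^ (p - 1) := by
    rw [Real.rpow_neg hc.le, Real.rpow_sub_one hA.ne', ← div_eq_mul_inv, div_div,
      div_le_div_iff₀ (by positivity) hA]
    linarith
  have hab : 0 ≤ a / b := div_nonneg ha hb.le
  have hcn := Real.rpow_nonneg hc.le (-e)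
  calc (a / b) ^ (1 / (p - 1)) * c ^ (-e / (p - 1))
      = (a / b * c ^ (-e)) ^ (1 / (p - 1)) := by
        rw [Real.mul_rpow hab hcn, ← Real.rpow_mul hc.le, mul_one_div]
    _ ≤ (A ^ (p - 1)) ^ (1 / (p - 1)) :=
        Real.rpow_le_rpow (mul_nonneg hab hcn) hbase (by positivity)
    _ = A := by
        rw [← Real.rpow_mul hA.le, mul_one_div_cancel hp'.ne', Real.rpow_one]

/-- lower bound on the gradient of a normalized solution, derived from the
equation identity (i) and the Pohozaev identity (ii). -/
theorem stmt_13 (N : ℕ) (hN : 3 ≤ N) (g G : ℝ → ℝ) (α β : ℝ)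
    (hg_cont : Continuous g) (hg_odd : ∀ s : ℝ, g (-s) = -g s)
    (hGdef : ∀ s : ℝ, G s = ∫ t in (0:ℝ)..s, g t)
    (hα : 2 + 4 / (N : ℝ) < α) (hαβ : α ≤ β) (hβ : β < 2 * (N : ℝ) / ((N : ℝ) - 2))
    (hAR : ∀ s : ℝ, s ≠ 0 → 0 < α * G s ∧ α * G s ≤ g s * s ∧ g s * s ≤ β * G s)
    (d C₂ : ℝ) (hd : 2 + 4 / (N : ℝ) < d) (hd' : d < 2 * (N : ℝ) / ((N : ℝ) - 2))
    (hC₂ : 0 < C₂) (hGle : ∀ s : ℝ, G s ≤ C₂ * |s| ^ d)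
    (V Vt : EuclideanSpace ℝ (Fin N) → ℝ) (hV : ContDiff ℝ 1 V)
    (hVt : ∀ x : EuclideanSpace ℝ (Fin N), Vt x = fderiv ℝ V x x)
    (hVtplusInt : Integrable (fun x : EuclideanSpace ℝ (Fin N) => max (Vt x) 0 ^ ((N : ℝ) / 2)))
    (S : ℝ) (hS : 0 < S)
    (hVtplus : (∫ x : EuclideanSpace ℝ (Fin N), max (Vt x) 0 ^ ((N : ℝ) / 2)) ^ (2 / (N : ℝ))
      < 2 * S)
    (CNd : ℝ) (hCNd : 0 < CNd)
    (hGN : ∀ w : EuclideanSpace ℝ (Fin N) → ℝ, ContDiff ℝ 1 w →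
      Integrable (fun x => |w x| ^ d) → Integrable (fun x => |w x| ^ 2) →
      Integrable (fun x => ‖fderiv ℝ w x‖ ^ 2) →
      (∫ x : EuclideanSpace ℝ (Fin N), |w x| ^ d) ≤
        CNd * (∫ x : EuclideanSpace ℝ (Fin N), |w x| ^ 2) ^ ((2 * d - (N : ℝ) * (d - 2)) / 4) *
          (∫ x : EuclideanSpace ℝ (Fin N), ‖fderiv ℝ w x‖ ^ 2) ^ ((N : ℝ) * (d - 2) / 4))
    (c lam : ℝ) (hc : 0 < c)
    (u : EuclideanSpace ℝ (Fin N) → ℝ) (hu : ContDiff ℝ 1 u) (hune : u ≠ 0)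
    (humass : (∫ x : EuclideanSpace ℝ (Fin N), |u x| ^ 2) = c)
    (hu2int : Integrable (fun x : EuclideanSpace ℝ (Fin N) => |u x| ^ 2))
    (hgradpos : 0 < ∫ x : EuclideanSpace ℝ (Fin N), ‖fderiv ℝ u x‖ ^ 2)
    (hgradint : Integrable (fun x : EuclideanSpace ℝ (Fin N) => ‖fderiv ℝ u x‖ ^ 2))
    (hustarint : Integrable
      (fun x : EuclideanSpace ℝ (Fin N) => |u x| ^ (2 * (N : ℝ) / ((N : ℝ) - 2))))
    (hVu2int : Integrable (fun x : EuclideanSpace ℝ (Fin N) => V x * u x ^ 2))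
    (hVtu2int : Integrable (fun x : EuclideanSpace ℝ (Fin N) => Vt x * u x ^ 2))
    (hguuint : Integrable (fun x : EuclideanSpace ℝ (Fin N) => g (u x) * u x))
    (hGuint : Integrable (fun x : EuclideanSpace ℝ (Fin N) => G (u x)))
    (hSobu : S * (∫ x : EuclideanSpace ℝ (Fin N), |u x| ^ (2 * (N : ℝ) / ((N : ℝ) - 2)))
        ^ (((N : ℝ) - 2) / (N : ℝ)) ≤ ∫ x : EuclideanSpace ℝ (Fin N), ‖fderiv ℝ u x‖ ^ 2)
    (hid1 : (∫ x : EuclideanSpace ℝ (Fin N), ‖fderiv ℝ u x‖ ^ 2) +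
        (∫ x : EuclideanSpace ℝ (Fin N), V x * u x ^ 2) + lam * c =
      ∫ x : EuclideanSpace ℝ (Fin N), g (u x) * u x)
    (hid2 : (((N : ℝ) - 2) / (2 * (N : ℝ))) * (∫ x : EuclideanSpace ℝ (Fin N), ‖fderiv ℝ u x‖ ^ 2) +
        (1 / (2 * (N : ℝ))) * (∫ x : EuclideanSpace ℝ (Fin N), Vt x * u x ^ 2) +
        (1 / 2) * (∫ x : EuclideanSpace ℝ (Fin N), V x * u x ^ 2) + (lam / 2) * c =
      ∫ x : EuclideanSpace ℝ (Fin N), G (u x)) :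
    (∫ x : EuclideanSpace ℝ (Fin N), ‖fderiv ℝ u x‖ ^ 2) ≥
      ((2 - (∫ x : EuclideanSpace ℝ (Fin N), max (Vt x) 0 ^ ((N : ℝ) / 2)) ^ (2 / (N : ℝ)) * S⁻¹) /
          ((N : ℝ) * CNd * C₂ * (β - 2))) ^ (4 / ((N : ℝ) * (d - 2) - 4)) *
        c ^ ((d * ((N : ℝ) - 2) - 2 * (N : ℝ)) / ((N : ℝ) * (d - 2) - 4)) := by
  have hN3 : (3 : ℝ) ≤ N := by exact_mod_cast hN
  have hN0 : (0 : ℝ) < N := by linarith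
  have hN2 : (0 : ℝ) < (N : ℝ) - 2 := by linarith
  have h4N : (0 : ℝ) < 4 / N := by positivity
  have hβ2 : 0 < β - 2 := by linarith
  have hNd : 4 < (N : ℝ) * (d - 2) := by
    rw [mul_comm]
    exact (div_lt_iff₀ hN0).1 (by linarith)
  have hum : AEStronglyMeasurable u := hu.continuous.aestronglyMeasurable
  have hVtc : Continuous Vt := by
    rw [funext hVt]
    exact (hV.continuous_fderiv one_ne_zero).clm_apply continuous_id
  have hudint : Integrable (fun x => |u x| ^ d) :=
    integrable_abs_rpow_of_le_of_le hum (by linarith) hd'.le two_pos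
      (by simpa only [Real.rpow_two] using hu2int) hustarint
  -- the nonlinear terms
  have hGu : ∫ x, G (u x) ≤ C₂ * ∫ x, |u x| ^ d := by
    rw [← integral_const_mul]
    exact integral_mono hGuint (hudint.const_mul C₂) fun x => hGle (u x)
  have hgu : ∫ x, g (u x) * u x ≤ β * ∫ x, G (u x) := by
    rw [← integral_const_mul]
    refine integral_mono hguuint (hGuint.const_mul β) fun x => ?_
    by_cases h : u x = 0
    · simp [h, hGdef]
    · exact (hAR _ h).2.2
  have hgn := hGN u hu hudint hu2int hgradint
  rw [humass] at hgn
  -- the potential term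
  have hconj : ((N : ℝ) / 2).HolderConjugate ((N : ℝ) / ((N : ℝ) - 2)) := by
    rw [Real.holderConjugate_iff]
    refine ⟨by linarith, ?_⟩
    field_simp
    ring
  have hhold := integral_mul_sq_le_of_holderConjugate hconj (fun x => le_max_right (Vt x) 0)
    (hVtc.max continuous_const).aestronglyMeasurable hum hVtplusInt
    (by simpa only [mul_div_assoc] using hustarint)
  rw [one_div_div, one_div_div, ← mul_div_assoc] at hhold
  have hVtle : ∫ x, Vt x * u x ^ 2 ≤ ∫ x, max (Vt x) 0 * u x ^ 2 := by
    refine integral_mono hVtu2int ?_ fun x =>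
      mul_le_mul_of_nonneg_right (le_max_left _ _) (sq_nonneg _)
    simpa only [max_mul_of_nonneg _ _ (sq_nonneg _), zero_mul] using hVtu2int.pos_part
  have hK0 : 0 ≤ (∫ x, max (Vt x) 0 ^ ((N : ℝ) / 2)) ^ (2 / (N : ℝ)) :=
    Real.rpow_nonneg (integral_nonneg fun x => Real.rpow_nonneg (le_max_right _ _) _) _
  set K := (∫ x, max (Vt x) 0 ^ ((N : ℝ) / 2)) ^ (2 / (N : ℝ))
  set A := ∫ x, ‖fderiv ℝ u x‖ ^ 2
  have hVtA : ∫ x, Vt x * u x ^ 2 ≤ K * S⁻¹ * A := by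
    refine (hVtle.trans hhold).trans ?_
    rw [mul_assoc]
    refine mul_le_mul_of_nonneg_left ?_ hK0
    rwa [inv_mul_eq_div, le_div_iff₀' hS]
  have hpoh : 2 * A - ∫ x, Vt x * u x ^ 2 =
      N * ((∫ x, g (u x) * u x) - 2 * ∫ x, G (u x)) := by
    rw [← hid1, ← hid2]
    field_simp
    ring
  have hmain : (2 - K * S⁻¹) * A ≤
      N * CNd * C₂ * (β - 2) * c ^ ((2 * d - (N : ℝ) * (d - 2)) / 4) *
        A ^ ((N : ℝ) * (d - 2) / 4) := by
    calc (2 - K * S⁻¹) * A ≤ 2 * A - ∫ x, Vt x * u x ^ 2 := by linarith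
      _ = N * ((∫ x, g (u x) * u x) - 2 * ∫ x, G (u x)) := hpoh
      _ ≤ N * ((β - 2) * (C₂ * (CNd * c ^ ((2 * d - (N : ℝ) * (d - 2)) / 4) *
            A ^ ((N : ℝ) * (d - 2) / 4)))) := by
          refine mul_le_mul_of_nonneg_left ?_ hN0.le
          refine le_trans ?_ (mul_le_mul_of_nonneg_left
            (hGu.trans (mul_le_mul_of_nonneg_left hgn hC₂.le)) hβ2.le)
          linarith
      _ = _ := by ring
  have hKS : 0 ≤ 2 - K * S⁻¹ := by
    rw [← div_eq_mul_inv, sub_nonneg, div_le_iff₀ hS]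
    exact hVtplus.le
  have hp1 : (N : ℝ) * (d - 2) / 4 - 1 = ((N : ℝ) * (d - 2) - 4) / 4 := by ring
  have hfinal := rpow_mul_rpow_le_of_mul_le hKS (by positivity) hc hgradpos (by linarith) hmain
  rw [hp1, one_div_div, ← neg_div, div_div_div_cancel_right₀ four_ne_zero] at hfinal
  convert hfinal using 4
  ring
end

section
/- Let d be a real number with 2 + 4/N < d < 2* and let C₂ > 0 satisfy G(s) ≤ C₂·|s|^d for all s ∈ ℝ. Let c > 0, λ ∈ ℝ, and let ω : ℝ^N → ℝ be continuously differentiable with 0 < ∫ |∇ω|² dx < ∞, 0 < ∫ |ω|² dx ≤ c, finite integrals ∫ g(ω)·ω dx and ∫ G(ω) dx, and satisfying the two identities ∫ |∇ω|² dx + λ·∫ |ω|² dx = ∫ g(ω)·ω dx and ((N−2)/(2N))·∫ |∇ω|² dx + (λ/2)·∫ |ω|² dx = ∫ G(ω) dx. Then ∫ |∇ω|² dx ≥ (2/(N·(β−2)·C₂·C_{N,d}))^{4/(N(d−2)−4)} · c^{(d(N−2)−2N)/(N(d−2)−4)}. -/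
open MeasureTheory

/-- Smooth cutoffs equal to one on arbitrarily large balls, with uniformly bounded gradient. -/
lemma exists_cutoff_fderiv_bounded (E : Type*) [NormedAddCommGroup E] [InnerProductSpace ℝ E]
    [FiniteDimensional ℝ E] :
    ∃ K : ℝ, ∀ R : ℝ, 1 ≤ R → ∃ χ : E → ℝ, ContDiff ℝ 1 χ ∧ HasCompactSupport χ ∧
      (∀ x ∈ Metric.closedBall (0 : E) R, χ x = 1) ∧
      ∀ x, 0 ≤ χ x ∧ χ x ≤ 1 ∧ ‖fderiv ℝ χ x‖ ≤ K := by
  let f : ContDiffBump (0 : E) := ⟨1, 2, one_pos, one_lt_two⟩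
  have hf : ContDiff ℝ 1 f := f.contDiff
  obtain ⟨K, hK⟩ := (hf.continuous_fderiv one_ne_zero).bounded_above_of_compact_support
    (f.hasCompactSupport.fderiv ℝ)
  refine ⟨K, fun R hR => ⟨fun x => f (R⁻¹ • x), ?_, ?_, ?_, ?_⟩⟩
  · exact hf.comp (contDiff_const_smul _)
  · exact f.hasCompactSupport.comp_smul (by positivity)
  · intro x hx
    apply f.one_of_mem_closedBall
    have hx' : ‖x‖ ≤ R := by simpa using hx
    have hR0 : 0 < R := by linarith
    simp only [mem_closedBall_zero_iff, norm_smul, norm_inv, Real.norm_eq_abs, abs_of_pos hR0]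
    change R⁻¹ * ‖x‖ ≤ 1
    rw [inv_mul_le_iff₀ hR0]
    linarith
  · intro x
    refine ⟨f.nonneg, f.le_one, ?_⟩
    have hR0 : 0 < R := by linarith
    have hR1 : |R|⁻¹ ≤ 1 := by
      rw [abs_of_pos hR0]
      exact inv_le_one_of_one_le₀ hR
    have h := fderiv_comp_smul (f := (f : E → ℝ)) (R⁻¹) (x := x) (𝕜 := ℝ)
    rw [h, norm_smul, norm_inv, Real.norm_eq_abs]
    exact (mul_le_of_le_one_left (norm_nonneg _) hR1).trans (hK _)

/-- If a Gagliardo–Nirenberg inequality holds for the `C¹` functions in `H¹ ∩ L^d`, then every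
`C¹` function in `H¹` belongs to `L^d`. -/
lemma integrable_abs_rpow_of_gagliardo_nirenberg {E : Type*} [NormedAddCommGroup E]
    [InnerProductSpace ℝ E] [FiniteDimensional ℝ E] [MeasurableSpace E] [BorelSpace E]
    {μ : Measure E} [IsFiniteMeasureOnCompacts μ] {d C p q : ℝ} (hd : 0 < d) (hC : 0 ≤ C)
    (hp : 0 ≤ p) (hq : 0 ≤ q)
    (hGN : ∀ w : E → ℝ, ContDiff ℝ 1 w → Integrable (fun x => |w x| ^ d) μ →
      Integrable (fun x => |w x| ^ 2) μ → Integrable (fun x => ‖fderiv ℝ w x‖ ^ 2) μ →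
      ∫ x, |w x| ^ d ∂μ ≤ C * (∫ x, |w x| ^ 2 ∂μ) ^ p * (∫ x, ‖fderiv ℝ w x‖ ^ 2 ∂μ) ^ q)
    {u : E → ℝ} (hu : ContDiff ℝ 1 u) (hu2 : Integrable (fun x => |u x| ^ 2) μ)
    (hdu : Integrable (fun x => ‖fderiv ℝ u x‖ ^ 2) μ) :
    Integrable (fun x => |u x| ^ d) μ := by
  obtain ⟨K, hK⟩ := exists_cutoff_fderiv_bounded E
  have hcont : Continuous fun x => |u x| ^ d :=
    hu.continuous.abs.rpow_const fun _ => Or.inr hd.le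
  have hmaj : Integrable (fun x => 2 * ‖fderiv ℝ u x‖ ^ 2 + 2 * K ^ 2 * |u x| ^ 2) μ :=
    (hdu.const_mul 2).add (hu2.const_mul (2 * K ^ 2))
  refine AECover.integrable_of_integral_norm_bounded
    (φ := fun n : ℕ => Metric.closedBall (0 : E) (n + 1))
    (aecover_closedBall (Filter.tendsto_atTop_add_const_right _ 1 tendsto_natCast_atTop_atTop))
    (C * (∫ x, |u x| ^ 2 ∂μ) ^ p *
      (∫ x, 2 * ‖fderiv ℝ u x‖ ^ 2 + 2 * K ^ 2 * |u x| ^ 2 ∂μ) ^ q)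
    (fun n => hcont.continuousOn.integrableOn_compact (isCompact_closedBall _ _))
    (Filter.Eventually.of_forall fun n => ?_)
  obtain ⟨χ, hχ, hsupp, hone, hbd⟩ := hK (n + 1) (by simp)
  set w : E → ℝ := fun x => χ x * u x with hw_def
  have hw : ContDiff ℝ 1 w := hχ.mul hu
  have hwsupp : HasCompactSupport w := hsupp.mul_right
  have hwd : Integrable (fun x => |w x| ^ d) μ := by
    have hs : HasCompactSupport fun x => |w x| ^ d :=
      hwsupp.comp_left (g := fun t : ℝ => |t| ^ d) (by simp [Real.zero_rpow hd.ne'])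
    have hc : Continuous fun x => |w x| ^ d :=
      hw.continuous.abs.rpow_const fun _ => Or.inr hd.le
    exact hc.integrable_of_hasCompactSupport hs
  have hw2 : Integrable (fun x => |w x| ^ 2) μ := by
    have hs : HasCompactSupport fun x => |w x| ^ 2 :=
      hwsupp.comp_left (g := fun t : ℝ => |t| ^ 2) (by simp)
    have hc : Continuous fun x => |w x| ^ 2 := hw.continuous.abs.pow 2
    exact hc.integrable_of_hasCompactSupport hs
  have hdw : Integrable (fun x => ‖fderiv ℝ w x‖ ^ 2) μ := by
    have hs : HasCompactSupport fun x => ‖fderiv ℝ w x‖ ^ 2 :=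
      (hwsupp.fderiv ℝ).comp_left (g := fun t => ‖t‖ ^ 2) (by simp)
    have hc : Continuous fun x => ‖fderiv ℝ w x‖ ^ 2 :=
      (hw.continuous_fderiv one_ne_zero).norm.pow 2
    exact hc.integrable_of_hasCompactSupport hs
  have hw2_le : ∫ x, |w x| ^ 2 ∂μ ≤ ∫ x, |u x| ^ 2 ∂μ := by
    refine integral_mono hw2 hu2 fun x => ?_
    obtain ⟨h0, h1, -⟩ := hbd x
    simp only [hw_def, abs_mul, abs_of_nonneg h0]
    gcongr
    exact mul_le_of_le_one_left (abs_nonneg _) h1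
  have hdw_le : ∫ x, ‖fderiv ℝ w x‖ ^ 2 ∂μ ≤
      ∫ x, 2 * ‖fderiv ℝ u x‖ ^ 2 + 2 * K ^ 2 * |u x| ^ 2 ∂μ := by
    refine integral_mono hdw hmaj fun x => ?_
    obtain ⟨h0, h1, hKx⟩ := hbd x
    have hfd : fderiv ℝ w x = χ x • fderiv ℝ u x + u x • fderiv ℝ χ x :=
      fderiv_fun_mul (hχ.differentiable one_ne_zero x) (hu.differentiable one_ne_zero x)
    have hle : ‖fderiv ℝ w x‖ ≤ ‖fderiv ℝ u x‖ + K * |u x| := by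
      rw [hfd]
      refine (norm_add_le _ _).trans (add_le_add ?_ ?_)
      · rw [norm_smul, Real.norm_eq_abs, abs_of_nonneg h0]
        exact mul_le_of_le_one_left (norm_nonneg _) h1
      · rw [norm_smul, Real.norm_eq_abs, mul_comm]
        gcongr
    calc ‖fderiv ℝ w x‖ ^ 2 ≤ (‖fderiv ℝ u x‖ + K * |u x|) ^ 2 := by gcongr
      _ ≤ 2 * ‖fderiv ℝ u x‖ ^ 2 + 2 * K ^ 2 * |u x| ^ 2 := by
        nlinarith [sq_nonneg (‖fderiv ℝ u x‖ - K * |u x|)]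
  calc ∫ x in Metric.closedBall (0 : E) (n + 1), ‖|u x| ^ d‖ ∂μ
      = ∫ x in Metric.closedBall (0 : E) (n + 1), |w x| ^ d ∂μ := by
        refine setIntegral_congr_fun measurableSet_closedBall fun x hx => ?_
        simp only [hw_def, hone x hx, one_mul, Real.norm_eq_abs]
        exact abs_of_nonneg (by positivity)
    _ ≤ ∫ x, |w x| ^ d ∂μ :=
        setIntegral_le_integral hwd (Filter.Eventually.of_forall fun x => by positivity)
    _ ≤ C * (∫ x, |w x| ^ 2 ∂μ) ^ p * (∫ x, ‖fderiv ℝ w x‖ ^ 2 ∂μ) ^ q :=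
        hGN w hw hwd hw2 hdw
    _ ≤ _ := by gcongr

/-- A positive number dominated by a superlinear power of itself is bounded below. -/
lemma rpow_mul_rpow_le_of_le_mul_rpow {A c L p q : ℝ} (hA : 0 < A) (hc : 0 < c) (hL : 0 < L)
    (hq : 1 < q) (h : A ≤ L * c ^ p * A ^ q) :
    L⁻¹ ^ (1 / (q - 1)) * c ^ (-p / (q - 1)) ≤ A := by
  have hq' : 0 < q - 1 := sub_pos.2 hq
  have hcp : 0 < c ^ p := Real.rpow_pos_of_pos hc p
  have hsplit : A ^ q = A ^ (q - 1) * A := by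
    rw [Real.rpow_sub_one hA.ne', div_mul_cancel₀ _ hA.ne']
  have h1 : 1 ≤ (L * c ^ p) * A ^ (q - 1) := by
    rw [hsplit, ← mul_assoc] at h
    exact le_of_mul_le_mul_right (by simpa using h) hA
  have h2 : L⁻¹ * c ^ (-p) ≤ A ^ (q - 1) := by
    rw [Real.rpow_neg hc.le, ← mul_inv]
    exact (inv_le_iff_one_le_mul₀' (by positivity)).2 h1
  calc L⁻¹ ^ (1 / (q - 1)) * c ^ (-p / (q - 1)) = (L⁻¹ * c ^ (-p)) ^ (1 / (q - 1)) := by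
        rw [Real.mul_rpow (by positivity) (by positivity), ← Real.rpow_mul hc.le, mul_one_div]
    _ ≤ (A ^ (q - 1)) ^ (1 / (q - 1)) := by gcongr
    _ = A := by rw [← Real.rpow_mul hA.le, mul_one_div_cancel hq'.ne', Real.rpow_one]

/-- lower bound on the gradient of a nontrivial solution `ω` of the limit
equation `−Δω + λω = g(ω)` with mass at most `c`. -/
theorem stmt_15 (N : ℕ) (hN : 3 ≤ N) (g G : ℝ → ℝ) (α β : ℝ)
    (hg_cont : Continuous g) (hg_odd : ∀ s : ℝ, g (-s) = -g s)
    (hGdef : ∀ s : ℝ, G s = ∫ t in (0:ℝ)..s, g t)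
    (hα : 2 + 4 / (N : ℝ) < α) (hαβ : α ≤ β) (hβ : β < 2 * (N : ℝ) / ((N : ℝ) - 2))
    (hAR : ∀ s : ℝ, s ≠ 0 → 0 < α * G s ∧ α * G s ≤ g s * s ∧ g s * s ≤ β * G s)
    (d C₂ : ℝ) (hd : 2 + 4 / (N : ℝ) < d) (hd' : d < 2 * (N : ℝ) / ((N : ℝ) - 2))
    (hC₂ : 0 < C₂) (hGle : ∀ s : ℝ, G s ≤ C₂ * |s| ^ d)
    (CNd : ℝ) (hCNd : 0 < CNd)
    (hGN : ∀ w : EuclideanSpace ℝ (Fin N) → ℝ, ContDiff ℝ 1 w →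
      Integrable (fun x => |w x| ^ d) → Integrable (fun x => |w x| ^ 2) →
      Integrable (fun x => ‖fderiv ℝ w x‖ ^ 2) →
      (∫ x : EuclideanSpace ℝ (Fin N), |w x| ^ d) ≤
        CNd * (∫ x : EuclideanSpace ℝ (Fin N), |w x| ^ 2) ^ ((2 * d - (N : ℝ) * (d - 2)) / 4) *
          (∫ x : EuclideanSpace ℝ (Fin N), ‖fderiv ℝ w x‖ ^ 2) ^ ((N : ℝ) * (d - 2) / 4))
    (c lam : ℝ) (hc : 0 < c)
    (ω : EuclideanSpace ℝ (Fin N) → ℝ) (hω : ContDiff ℝ 1 ω)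
    (hgradpos : 0 < ∫ x : EuclideanSpace ℝ (Fin N), ‖fderiv ℝ ω x‖ ^ 2)
    (hgradint : Integrable (fun x : EuclideanSpace ℝ (Fin N) => ‖fderiv ℝ ω x‖ ^ 2))
    (hω2int : Integrable (fun x : EuclideanSpace ℝ (Fin N) => |ω x| ^ 2))
    (hmasspos : 0 < ∫ x : EuclideanSpace ℝ (Fin N), |ω x| ^ 2)
    (hmassle : (∫ x : EuclideanSpace ℝ (Fin N), |ω x| ^ 2) ≤ c)
    (hgωint : Integrable (fun x : EuclideanSpace ℝ (Fin N) => g (ω x) * ω x))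
    (hGωint : Integrable (fun x : EuclideanSpace ℝ (Fin N) => G (ω x)))
    (hid1 : (∫ x : EuclideanSpace ℝ (Fin N), ‖fderiv ℝ ω x‖ ^ 2) +
        lam * (∫ x : EuclideanSpace ℝ (Fin N), |ω x| ^ 2) =
      ∫ x : EuclideanSpace ℝ (Fin N), g (ω x) * ω x)
    (hid2 : (((N : ℝ) - 2) / (2 * (N : ℝ))) *
          (∫ x : EuclideanSpace ℝ (Fin N), ‖fderiv ℝ ω x‖ ^ 2) +
        (lam / 2) * (∫ x : EuclideanSpace ℝ (Fin N), |ω x| ^ 2) =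
      ∫ x : EuclideanSpace ℝ (Fin N), G (ω x)) :
    (∫ x : EuclideanSpace ℝ (Fin N), ‖fderiv ℝ ω x‖ ^ 2) ≥
      (2 / ((N : ℝ) * (β - 2) * C₂ * CNd)) ^ (4 / ((N : ℝ) * (d - 2) - 4)) *
        c ^ ((d * ((N : ℝ) - 2) - 2 * (N : ℝ)) / ((N : ℝ) * (d - 2) - 4)) := by
  have hN3 : (3 : ℝ) ≤ N := by exact_mod_cast hN
  have hN0 : (0 : ℝ) < N := by linarith
  have hN2 : (0 : ℝ) < (N : ℝ) - 2 := by linarith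
  have h4N : 0 < 4 / (N : ℝ) := by positivity
  have hd0 : 0 < d := by linarith
  have hβ2 : 0 < β - 2 := by linarith
  have hp : 0 < (2 * d - (N : ℝ) * (d - 2)) / 4 := by
    have := (lt_div_iff₀ hN2).1 hd'
    linarith
  have hq : 1 < (N : ℝ) * (d - 2) / 4 := by
    have : 4 / (N : ℝ) < d - 2 := by linarith
    rw [div_lt_iff₀ hN0] at this
    linarith
  have hωd : Integrable (fun x => |ω x| ^ d) :=
    integrable_abs_rpow_of_gagliardo_nirenberg hd0 hCNd.le hp.le (by linarith) hGN hω hω2int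
      hgradint
  have hGN_ω := hGN ω hω hωd hω2int hgradint
  have hGd : ∫ x, G (ω x) ≤ C₂ * ∫ x, |ω x| ^ d := by
    rw [← integral_const_mul]
    exact integral_mono hGωint (hωd.const_mul C₂) fun x => hGle _
  have hgG : ∫ x, g (ω x) * ω x ≤ β * ∫ x, G (ω x) := by
    rw [← integral_const_mul]
    refine integral_mono hgωint (hGωint.const_mul β) fun x => ?_
    rcases eq_or_ne (ω x) 0 with h | h
    · simp [h, hGdef]
    · exact (hAR _ h).2.2
  set A := ∫ x, ‖fderiv ℝ ω x‖ ^ 2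
  set M := ∫ x, |ω x| ^ 2
  have hMp : M ^ ((2 * d - (N : ℝ) * (d - 2)) / 4) ≤ c ^ ((2 * d - (N : ℝ) * (d - 2)) / 4) := by
    gcongr
  have hid : A = N / 2 * ((∫ x, g (ω x) * ω x) - 2 * ∫ x, G (ω x)) := by
    rw [← hid1, ← hid2]
    field_simp
    ring
  have hA : A ≤ (N * (β - 2) * C₂ * CNd / 2) * c ^ ((2 * d - (N : ℝ) * (d - 2)) / 4) *
      A ^ ((N : ℝ) * (d - 2) / 4) :=
    calc A ≤ N / 2 * ((β - 2) * ∫ x, G (ω x)) := by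
          rw [hid]
          gcongr
          linarith
      _ ≤ N / 2 * ((β - 2) * (C₂ * (CNd * c ^ ((2 * d - (N : ℝ) * (d - 2)) / 4) *
            A ^ ((N : ℝ) * (d - 2) / 4)))) := by
          gcongr
          refine hGd.trans ?_
          gcongr
          refine hGN_ω.trans ?_
          gcongr
      _ = _ := by ring
  have hres := rpow_mul_rpow_le_of_le_mul_rpow hgradpos hc (by positivity) hq hA
  have hq4 : (N : ℝ) * (d - 2) / 4 - 1 = ((N : ℝ) * (d - 2) - 4) / 4 := by ring
  have he₁ : 1 / ((N : ℝ) * (d - 2) / 4 - 1) = 4 / ((N : ℝ) * (d - 2) - 4) := by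
    rw [hq4, one_div_div]
  have he₂ : -((2 * d - (N : ℝ) * (d - 2)) / 4) / ((N : ℝ) * (d - 2) / 4 - 1) =
      (d * ((N : ℝ) - 2) - 2 * (N : ℝ)) / ((N : ℝ) * (d - 2) - 4) := by
    rw [hq4, ← neg_div, div_div_div_cancel_right₀ four_ne_zero]
    congr 1
    ring
  rwa [he₁, he₂, inv_div] at hres
end
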